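/- arXiv:1905.10879 — 3 statements merged into one kernel-verified Lean document; each statement's English description precedes it below -/
import Mathlib

section
/- Let n ≥ 1, m ≥ 1, and 1 ≤ r ≤ n be integers; for each i ∈ {1,…,r} let a_{1,i},…,a_{m,i} be integers, not all zero, and b_i an integer; let Φ : ℝⁿ × ℂᵐ → ℂ be smooth in y with support (in y) in the open polydisc {|y_i| < 1, i = 1,…,n}, holomorphic in s, and jointly continuous; and suppose the region ℛ = ⋂_{i=1}^{r} {s ∈ ℂᵐ : ∑_{j=1}^{m} a_{j,i} Re(s_j) + b_i > 0} is nonempty. Let P = ⋃_{i=1}^{r} ⋃_{t∈ℕ} {s ∈ ℂᵐ : ∑_{j=1}^{m} a_{j,i} s_j + b_i + t = 0}. Then there exists a holomorphic function F on the open set ℂᵐ ∖ P such that F(s) = ∫_{ℝⁿ} Φ(y, s) ∏_{i=1}^{r} |y_i|^{∑_{j=1}^{m} a_{j,i} s_j + b_i − 1} dy for all s ∈ ℛ ∖ P; that is, the monomial integral J(s) admits an analytic continuation to the whole ℂᵐ as a meromorphic function with poles contained in P. -/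
open MeasureTheory Finset

/-- The monomial integrand `Φ(y,s) ∏_{i=1}^{r} |y_i|^{∑_j a_{j,i} s_j + b_i - 1}`,
where `a i j` denotes `a_{j,i}` and `b i` denotes `b_i`. -/
noncomputable def monomialIntegrand (n m r : ℕ) (hrn : r ≤ n)
    (a : Fin r → Fin m → ℤ) (b : Fin r → ℤ)
    (Φ : (Fin n → ℝ) → (Fin m → ℂ) → ℂ) (s : Fin m → ℂ) (y : Fin n → ℝ) : ℂ :=
  Φ y s * ∏ i : Fin r,
    ((|y (Fin.castLE hrn i)| : ℝ) : ℂ) ^ ((∑ j, (a i j : ℂ) * s j) + (b i : ℂ) - 1)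

/-- The region `ℛ = ⋂_i {s : ∑_j a_{j,i} Re(s_j) + b_i > 0}`. -/
def monomialRegion (m r : ℕ) (a : Fin r → Fin m → ℤ) (b : Fin r → ℤ) :
    Set (Fin m → ℂ) :=
  {s | ∀ i, 0 < (∑ j, (a i j : ℝ) * (s j).re) + (b i : ℝ)}

/-- The candidate polar locus `P = ⋃_i ⋃_{t ∈ ℕ} {s : ∑_j a_{j,i} s_j + b_i + t = 0}`. -/
def monomialPolarLocus (m r : ℕ) (a : Fin r → Fin m → ℤ) (b : Fin r → ℤ) :
    Set (Fin m → ℂ) :=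
  ⋃ i : Fin r, ⋃ t : ℕ, {s | (∑ j, (a i j : ℂ) * s j) + (b i : ℂ) + (t : ℂ) = 0}

section Hartogs

open Filter Metric Real Topology

theorem posLog_norm_le_circleAverage {f : ℂ → ℂ} (hf : Differentiable ℂ f) (c : ℂ) {R : ℝ}
    (hR : 0 < R) : log⁺ ‖f c‖ ≤ circleAverage (fun z => log⁺ ‖f z‖) c R := by
  have hnonneg : 0 ≤ circleAverage (fun z => log⁺ ‖f z‖) c R :=
    circleAverage_nonneg_of_nonneg fun z _ => posLog_nonneg
  rcases eq_or_ne (f c) 0 with h0 | h0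
  · simpa [h0] using hnonneg
  have han : AnalyticOnNhd ℂ f Set.univ := fun z _ => hf.analyticAt z
  have hanB := han.mono (Set.subset_univ (closedBall c |R|))
  have hlog : log ‖f c‖ ≤ circleAverage (fun z => log ‖f z‖) c R := by
    rw [hanB.circleAverage_log_norm hR.ne' h0]
    refine le_add_of_nonneg_left (finsum_nonneg fun u => ?_)
    by_cases hu : u ∈ closedBall c |R|
    · refine mul_nonneg ?_ ?_
      · exact_mod_cast MeromorphicOn.AnalyticOnNhd.divisor_nonneg hanB u
      · rcases eq_or_ne u c with rfl | huc
        · simp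
        · apply log_nonneg
          have : 0 < ‖c - u‖ := norm_pos_iff.2 (sub_ne_zero.2 huc.symm)
          rw [← div_eq_mul_inv, one_le_div this]
          rw [mem_closedBall', dist_eq_norm, abs_of_pos hR] at hu
          exact hu
    · rw [Function.locallyFinsuppWithin.apply_eq_zero_of_notMem _ hu]
      simp
  have hmono : circleAverage (fun z => log ‖f z‖) c R ≤ circleAverage (fun z => log⁺ ‖f z‖) c R :=
    circleAverage_mono
      (han.mono (Set.subset_univ _)).meromorphicOn.circleIntegrable_log_norm
      (han.mono (Set.subset_univ _)).meromorphicOn.circleIntegrable_posLog_norm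
      fun z _ => le_max_right _ _
  exact max_le hnonneg (hlog.trans hmono)

theorem setIntegral_closedBall_comp_smul {ι : Type*} [Fintype ι] (g : (ι → ℂ) → ℝ) (r : ℝ)
    (w : Circle) :
    ∫ v in closedBall (0 : ι → ℂ) r, g ((w : ℂ) • v) = ∫ v in closedBall (0 : ι → ℂ) r, g v := by
  have hmp : MeasurePreserving (fun v : ι → ℂ => fun i => rotation w (v i)) :=
    volume_preserving_pi fun _ => (rotation w).measurePreserving
  have hemb : MeasurableEmbedding (fun v : ι → ℂ => fun i => rotation w (v i)) :=
    (MeasurableEquiv.piCongrRight fun _ : ι =>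
      (rotation w).toHomeomorph.toMeasurableEquiv).measurableEmbedding
  have := hmp.setIntegral_preimage_emb hemb g (closedBall 0 r)
  rw [← this]
  have hpre : (fun v : ι → ℂ => fun i => rotation w (v i)) ⁻¹' closedBall 0 r = closedBall 0 r := by
    ext v
    by_cases hr : 0 ≤ r
    · have hw : ‖(w : ℂ)‖ = 1 := w.norm_coe
      simp [pi_norm_le_iff_of_nonneg hr, hw]
    · have h : closedBall (0 : ι → ℂ) r = ∅ := closedBall_eq_empty.2 (not_le.1 hr)
      simp [h]
  rw [hpre]
  rfl

theorem measureReal_closedBall_mul_posLog_norm_le {ι : Type*} [Fintype ι] {f : (ι → ℂ) → ℂ}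
    (hf : Differentiable ℂ f) (s : ι → ℂ) (r : ℝ) :
    volume.real (closedBall (0 : ι → ℂ) r) * log⁺ ‖f s‖ ≤
      ∫ v in closedBall s r, log⁺ ‖f v‖ := by
  have hcont : Continuous fun v => log⁺ ‖f v‖ := continuous_posLog.comp hf.continuous.norm
  have htrans : ∫ v in closedBall s r, log⁺ ‖f v‖
      = ∫ v in closedBall (0 : ι → ℂ) r, log⁺ ‖f (s + v)‖ := by
    have := (measurePreserving_add_left (volume : Measure (ι → ℂ)) s).setIntegral_preimage_emb
      (measurableEmbedding_addLeft s) (fun v => log⁺ ‖f v‖) (closedBall s r)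
    rw [← this]
    simp
  have hfin : IsFiniteMeasure (volume.restrict (closedBall (0 : ι → ℂ) r)) :=
    ⟨by simpa using (isCompact_closedBall (0 : ι → ℂ) r).measure_lt_top⟩
  have hpt : ∀ v : ι → ℂ, log⁺ ‖f s‖ ≤
      (2 * π)⁻¹ * ∫ θ in Set.Ioc 0 (2 * π), log⁺ ‖f (s + circleMap 0 1 θ • v)‖ := by
    intro v
    have := posLog_norm_le_circleAverage (f := fun z : ℂ => f (s + z • v))
      (hf.comp (by fun_prop)) 0 one_pos
    rw [circleAverage_def, intervalIntegral.integral_of_le two_pi_pos.le] at this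
    simpa using this
  have hint : Integrable (fun p : (ι → ℂ) × ℝ => log⁺ ‖f (s + circleMap 0 1 p.2 • p.1)‖)
      ((volume.restrict (closedBall (0 : ι → ℂ) r)).prod (volume.restrict (Set.Ioc 0 (2 * π)))) := by
    rw [Measure.prod_restrict]
    have hc : Continuous fun p : (ι → ℂ) × ℝ => log⁺ ‖f (s + circleMap 0 1 p.2 • p.1)‖ := by
      refine hcont.comp ?_
      simp only [circleMap]
      fun_prop
    exact (hc.continuousOn.integrableOn_compact
      ((isCompact_closedBall (0 : ι → ℂ) r).prod isCompact_Icc)).mono_set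
        (Set.prod_mono_right Set.Ioc_subset_Icc_self)
  calc volume.real (closedBall (0 : ι → ℂ) r) * log⁺ ‖f s‖
      = ∫ v in closedBall (0 : ι → ℂ) r, log⁺ ‖f s‖ := by simp
    _ ≤ ∫ v in closedBall (0 : ι → ℂ) r,
          (2 * π)⁻¹ * ∫ θ in Set.Ioc 0 (2 * π), log⁺ ‖f (s + circleMap 0 1 θ • v)‖ :=
        integral_mono (integrable_const _) (hint.integral_prod_left.const_mul _) hpt
    _ = (2 * π)⁻¹ * ∫ θ in Set.Ioc 0 (2 * π), ∫ v in closedBall (0 : ι → ℂ) r,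
          log⁺ ‖f (s + circleMap 0 1 θ • v)‖ := by
        rw [integral_const_mul, integral_integral_swap hint]
    _ = (2 * π)⁻¹ * ∫ θ in Set.Ioc 0 (2 * π), ∫ v in closedBall (0 : ι → ℂ) r,
          log⁺ ‖f (s + v)‖ := by
        congr 1
        refine integral_congr_ae (ae_of_all _ fun θ => ?_)
        have := setIntegral_closedBall_comp_smul (fun v => log⁺ ‖f (s + v)‖) r (Circle.exp θ)
        simpa [circleMap] using this
    _ = ∫ v in closedBall s r, log⁺ ‖f v‖ := by
        rw [htrans, setIntegral_const]
        simp [two_pi_pos.le]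
        field_simp

/-- A form of Hartogs' lemma: a locally bounded family of entire functions that decays faster than
every power of `T` at each point does so locally uniformly. -/
theorem eventually_forall_norm_mul_pow_le_one {ι X : Type*} [Fintype ι] {l : Filter X}
    [l.IsCountablyGenerated] {f : X → (ι → ℂ) → ℂ} {T : X → ℝ} {s₀ : ι → ℂ} {C : ℝ}
    (hf : ∀ x, Differentiable ℂ (f x)) (hT : Tendsto T l atTop)
    (hC : ∀ x, ∀ s ∈ closedBall s₀ 2, ‖f x s‖ ≤ C)
    (hdecay : ∀ s, ∀ N : ℕ, ∀ᶠ x in l, ‖f x s‖ * T x ^ N ≤ 1) (N : ℕ) :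
    ∀ᶠ x in l, ∀ s ∈ closedBall s₀ 1, ‖f x s‖ * T x ^ N ≤ 1 := by
  set w : X → (ι → ℂ) → ℝ := fun x s => log⁺ (‖f x s‖ * T x ^ (N + 1)) / log (T x) with hw
  have hC' : ∀ x, ∀ s ∈ closedBall s₀ 2, ‖f x s‖ ≤ max C 1 := fun x s hs =>
    (hC x s hs).trans (le_max_left _ _)
  have hlim : Tendsto (fun x => ∫ s in closedBall s₀ 2, w x s) l
      (𝓝 (∫ s in closedBall s₀ 2, (0 : ℝ))) := by
    refine tendsto_integral_filter_of_dominated_convergence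
      (fun _ => log (max C 1) + (N + 1 : ℕ)) ?_ ?_ ?_ ?_
    · refine Eventually.of_forall fun x => Continuous.aestronglyMeasurable ?_
      have := (hf x).continuous
      have := continuous_posLog
      fun_prop
    · filter_upwards [hT.eventually_ge_atTop (exp 1)] with x hx
      have hlogT : 1 ≤ log (T x) := by
        rw [le_log_iff_exp_le ((exp_pos 1).trans_le hx)]; exact hx
      have hT1 : 1 ≤ T x := le_trans (by simp) hx
      refine (ae_restrict_mem measurableSet_closedBall).mono fun s hs => ?_
      rw [Real.norm_of_nonneg (div_nonneg posLog_nonneg (by linarith)), div_le_iff₀ (by linarith)]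
      calc log⁺ (‖f x s‖ * T x ^ (N + 1)) ≤ log⁺ (max C 1 * T x ^ (N + 1)) :=
            posLog_le_posLog (by positivity) (by gcongr; exact hC' x s hs)
        _ = log (max C 1 * T x ^ (N + 1)) := by
            refine posLog_eq_log (le_trans ?_ (le_abs_self _))
            exact one_le_mul_of_one_le_of_one_le (le_max_right _ _) (one_le_pow₀ hT1)
        _ = log (max C 1) + (N + 1 : ℕ) * log (T x) := by
            rw [log_mul (by positivity) (by positivity), log_pow]
        _ ≤ _ := by
            have : 0 ≤ log (max C 1) := log_nonneg (le_max_right _ _)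
            nlinarith
    · have : IsFiniteMeasure (volume.restrict (closedBall s₀ 2)) :=
        ⟨by simpa using (isCompact_closedBall s₀ 2).measure_lt_top⟩
      exact integrable_const _
    · refine ae_of_all _ fun s => ?_
      refine tendsto_const_nhds.congr' ?_
      filter_upwards [hdecay s (N + 1), hT.eventually_ge_atTop 0] with x hx hx0
      have : log⁺ (‖f x s‖ * T x ^ (N + 1)) = 0 := by
        rw [posLog_eq_zero_iff, abs_of_nonneg (by positivity)]; exact hx
      simp [hw, this]
  rw [integral_zero] at hlim
  have hvol : 0 < volume.real (closedBall (0 : ι → ℂ) 1) :=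
    ENNReal.toReal_pos (measure_closedBall_pos _ _ one_pos).ne'
      (isCompact_closedBall _ _).measure_lt_top.ne
  filter_upwards [hlim.eventually_le_const hvol, hT.eventually_ge_atTop (exp 1)] with x hx hTx s hs
  have hlogT : 1 ≤ log (T x) := by
    rw [le_log_iff_exp_le ((exp_pos 1).trans_le hTx)]; exact hTx
  have hT0 : 0 < T x := (exp_pos 1).trans_le hTx
  have hnorm : ∀ v, ‖f x v * (T x : ℂ) ^ (N + 1)‖ = ‖f x v‖ * T x ^ (N + 1) := by
    intro v; simp [abs_of_pos hT0]
  have hsub := measureReal_closedBall_mul_posLog_norm_le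
    (f := fun v => f x v * (T x : ℂ) ^ (N + 1)) ((hf x).mul_const _) s 1
  simp only [hnorm] at hsub
  have hcont : Continuous fun v => log⁺ (‖f x v‖ * T x ^ (N + 1)) := by
    have := (hf x).continuous
    have := continuous_posLog
    fun_prop
  have hmono : ∫ v in closedBall s 1, log⁺ (‖f x v‖ * T x ^ (N + 1)) ≤
      ∫ v in closedBall s₀ 2, log⁺ (‖f x v‖ * T x ^ (N + 1)) := by
    refine setIntegral_mono_set (hcont.continuousOn.integrableOn_compact (isCompact_closedBall _ _))
      (ae_of_all _ fun _ => posLog_nonneg) (LE.le.eventuallyLE ?_)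
    refine closedBall_subset_closedBall' ?_
    have := mem_closedBall.1 hs
    linarith
  simp only [hw, integral_div] at hx
  rw [div_le_iff₀ (by linarith)] at hx
  have h1 : log⁺ (‖f x s‖ * T x ^ (N + 1)) ≤ log (T x) :=
    le_of_mul_le_mul_left (hsub.trans (hmono.trans hx)) hvol
  have h2 : ‖f x s‖ * T x ^ (N + 1) ≤ T x := by
    rcases (norm_nonneg (f x s)).eq_or_lt with h | h
    · rw [← h]; simpa using hT0.le
    · exact (log_le_log_iff (by positivity) hT0).1 ((le_max_right _ _).trans h1)
  rw [pow_succ, ← mul_assoc] at h2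
  exact le_of_mul_le_mul_right (by simpa using h2) hT0

end Hartogs

section ParametricIntegral

open Filter Metric Topology

theorem DifferentiableOn.integral_of_dominated {α ι : Type*} [MeasurableSpace α] [Fintype ι]
    {μ : Measure α} {f : (ι → ℂ) → α → ℂ} {U : Set (ι → ℂ)} (hU : IsOpen U)
    (hmeas : ∀ s ∈ U, AEStronglyMeasurable (f s) μ)
    (hdiff : ∀ x, DifferentiableOn ℂ (fun s => f s x) U)
    (hbound : ∀ s₀ ∈ U, ∃ g : α → ℝ, Integrable g μ ∧ ∀ᶠ s in 𝓝 s₀, ∀ x, ‖f s x‖ ≤ g x) :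
    DifferentiableOn ℂ (fun s => ∫ x, f s x ∂μ) U := by
  classical
  intro s₀ hs₀
  obtain ⟨g, hg, hfg⟩ := hbound s₀ hs₀
  obtain ⟨ε, hε, hball⟩ := Metric.mem_nhds_iff.1 (hfg.and (hU.mem_nhds hs₀))
  have hdiffAt : ∀ s ∈ U, ∀ x, HasFDerivAt (fun s => f s x) (fderiv ℂ (fun s => f s x) s) s :=
    fun s hs x => ((hdiff x).differentiableAt (hU.mem_nhds hs)).hasFDerivAt
  have hsub : ∀ s ∈ ball s₀ (ε / 2), ball s (ε / 2) ⊆ ball s₀ ε := by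
    intro s hs
    refine ball_subset_ball' ?_
    have := mem_ball.1 hs
    linarith
  refine (hasFDerivAt_integral_of_dominated_of_fderiv_le (𝕜 := ℂ) (s := ball s₀ (ε / 2))
    (F := f) (F' := fun s x => fderiv ℂ (fun s => f s x) s)
    (bound := fun x => 2 * g x / (ε / 2)) (ball_mem_nhds _ (by positivity)) ?_ ?_ ?_ ?_ ?_ ?_
    ).differentiableAt.differentiableWithinAt
  · filter_upwards [hU.mem_nhds hs₀] with s hs using hmeas s hs
  · exact hg.mono' (hmeas s₀ hs₀) (ae_of_all _ fun x => (hball (mem_ball_self hε)).1 x)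
  · have hrep : ∀ x, fderiv ℂ (fun s => f s x) s₀ = ∑ i,
        (ContinuousLinearMap.proj (R := ℂ) (φ := fun _ : ι => ℂ) i).smulRight
          (fderiv ℂ (fun s => f s x) s₀ (Pi.single i 1)) := by
      intro x
      ext v
      generalize fderiv ℂ (fun s => f s x) s₀ = L
      rw [_root_.sum_apply, ← ContinuousLinearMap.coe_coe, L.toLinearMap.pi_apply_eq_sum_univ v]
      refine Finset.sum_congr rfl fun i _ => ?_
      simp only [ContinuousLinearMap.smulRight_apply, ContinuousLinearMap.proj_apply]
      congr 2
      ext j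
      rw [Pi.single_apply]
      exact if_congr eq_comm rfl rfl
    refine AEStronglyMeasurable.congr ?_ (ae_of_all _ fun x => (hrep x).symm)
    refine Finset.aestronglyMeasurable_fun_sum _ fun i _ => ?_
    have hlin : Continuous fun z : ℂ =>
        (ContinuousLinearMap.proj (R := ℂ) (φ := fun _ : ι => ℂ) i).smulRight z :=
      (ContinuousLinearMap.smulRightL ℂ (ι → ℂ) ℂ
        (ContinuousLinearMap.proj (R := ℂ) (φ := fun _ : ι => ℂ) i)).continuous
    refine hlin.comp_aestronglyMeasurable ?_
    have hstep : Tendsto (fun n : ℕ => s₀ + ((n : ℂ) + 1)⁻¹ • Pi.single i (1 : ℂ)) atTop (𝓝 s₀) := by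
      have : Tendsto (fun n : ℕ => ((n : ℂ) + 1)⁻¹) atTop (𝓝 0) := by
        simpa using tendsto_one_div_add_atTop_nhds_zero_nat (𝕜 := ℂ)
      simpa using (this.smul_const (Pi.single i (1 : ℂ) : ι → ℂ)).const_add s₀
    obtain ⟨n₀, hn₀⟩ := eventually_atTop.1 (hstep.eventually (hU.mem_nhds hs₀))
    refine aestronglyMeasurable_of_tendsto_ae atTop (f := fun (n : ℕ) x =>
      ((n + n₀ : ℕ) + 1 : ℂ) • (f (s₀ + (((n + n₀ : ℕ) : ℂ) + 1)⁻¹ • Pi.single i (1 : ℂ)) x - f s₀ x))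
      (fun n => ?_) (ae_of_all _ fun x => ?_)
    · have hsub := (hmeas _ (hn₀ (n + n₀) (Nat.le_add_left _ _))).sub (hmeas s₀ hs₀)
      simp only [smul_eq_mul]
      exact hsub.const_mul _
    have hline := (hdiffAt s₀ hs₀ x).lim (Pi.single i (1 : ℂ)) (c := fun n : ℕ => (n : ℂ) + 1)
      (l := atTop) ?_
    · exact (hline.comp (tendsto_add_atTop_nat n₀))
    · have : Tendsto (fun n : ℕ => ((n + 1 : ℕ) : ℝ)) atTop atTop :=
        tendsto_natCast_atTop_atTop.comp (tendsto_add_atTop_nat 1)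
      refine this.congr fun n => ?_
      rw [← Nat.cast_add_one, Complex.norm_natCast]
  · refine ae_of_all _ fun x s hs => ?_
    refine Complex.norm_fderiv_le_div_of_mapsTo_ball
      ((hdiff x).mono fun z hz => (hball (hsub s hs hz)).2) (fun z hz => ?_) (by positivity)
    have h1 := (hball (hsub s hs hz)).1 x
    have h2 := (hball (hsub s hs (mem_ball_self (by positivity)))).1 x
    rw [mem_closedBall, dist_eq_norm]
    exact (norm_sub_le _ _).trans (by linarith)
  · exact (hg.const_mul 2).div_const _
  · refine ae_of_all _ fun x s hs => hdiffAt s (hball ?_).2 x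
    exact ball_subset_ball (by linarith) hs

end ParametricIntegral

section OscillatoryMellin

open Filter Metric Topology Real

/-- The entire-in-`z` function `∑ z ^ j / (j! (l + j))`, which for `0 < re l` is
`∫ x in 0..1, x ^ (l - 1) * exp (z * x)`. -/
noncomputable def mellinExp (l z : ℂ) : ℂ := ∑' j : ℕ, z ^ j / (j.factorial * (l + j))

theorem exists_pos_forall_le_norm_add_natCast {l : ℂ} (hl : ∀ t : ℕ, l + t ≠ 0) :
    ∃ δ > 0, ∀ l' ∈ ball l δ, ∀ j : ℕ, δ ≤ ‖l' + j‖ := by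
  have hclosed : IsClosed (Set.range fun t : ℕ => -(t : ℂ)) := by
    have h := (Complex.isometry_ofReal.isClosedEmbedding.comp Nat.isClosedEmbedding_coe_real).isClosed_range
    have := (Homeomorph.neg ℂ).isClosedMap _ h
    rw [← Set.range_comp] at this
    simpa [Function.comp_def] using this
  have hmem : (Set.range fun t : ℕ => -(t : ℂ))ᶜ ∈ 𝓝 l := by
    refine hclosed.isOpen_compl.mem_nhds ?_
    rintro ⟨t, ht⟩
    exact hl t (by rw [← ht]; ring)
  obtain ⟨ε, hε, hsub⟩ := Metric.mem_nhds_iff.1 hmem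
  refine ⟨ε / 2, by positivity, fun l' hl' j => ?_⟩
  by_contra! h
  refine hsub (a := -(j : ℂ)) ?_ ⟨j, rfl⟩
  rw [mem_ball, dist_eq_norm] at *
  calc ‖-(j : ℂ) - l‖ = ‖(l' - l) - (l' + j)‖ := by congr 1; ring
    _ ≤ ‖l' - l‖ + ‖l' + j‖ := norm_sub_le _ _
    _ < ε := by linarith

theorem norm_mellinExp_term_le {l z : ℂ} {δ : ℝ} (hδ : 0 < δ) {j : ℕ} (h : δ ≤ ‖l + j‖) :
    ‖z ^ j / (j.factorial * (l + j))‖ ≤ ‖z‖ ^ j / j.factorial * δ⁻¹ := by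
  rw [norm_div, norm_mul, norm_pow, Complex.norm_natCast, ← div_div, div_eq_mul_inv _ ‖l + j‖]
  gcongr

theorem summable_mellinExp {l : ℂ} (hl : ∀ t : ℕ, l + t ≠ 0) (z : ℂ) :
    Summable fun j : ℕ => z ^ j / (j.factorial * (l + j)) := by
  obtain ⟨δ, hδ, h⟩ := exists_pos_forall_le_norm_add_natCast hl
  exact .of_norm_bounded ((summable_pow_div_factorial ‖z‖).mul_right δ⁻¹)
    fun j => norm_mellinExp_term_le hδ (h l (mem_ball_self hδ) j)

theorem differentiableAt_mellinExp {l : ℂ} (hl : ∀ t : ℕ, l + t ≠ 0) (z : ℂ) :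
    DifferentiableAt ℂ (fun l => mellinExp l z) l := by
  obtain ⟨δ, hδ, h⟩ := exists_pos_forall_le_norm_add_natCast hl
  refine (Complex.differentiableOn_tsum_of_summable_norm
    ((summable_pow_div_factorial ‖z‖).mul_right δ⁻¹) (fun j l' hl' => ?_) isOpen_ball
    fun j l' hl' => norm_mellinExp_term_le hδ (h l' hl' j)).differentiableAt (ball_mem_nhds l hδ)
  have : l' + j ≠ 0 := norm_pos_iff.1 (hδ.trans_le (h l' hl' j))
  refine DifferentiableAt.differentiableWithinAt ?_
  have : (j.factorial : ℂ) * (l' + j) ≠ 0 := mul_ne_zero (Nat.cast_ne_zero.2 j.factorial_ne_zero) this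
  exact (differentiableAt_const _).div (by fun_prop) this

theorem measurable_mellinExp {l : ℂ} (hl : ∀ t : ℕ, l + t ≠ 0) :
    Measurable (mellinExp l) := by
  refine measurable_of_tendsto_metrizable (f := fun (N : ℕ) (z : ℂ) =>
    ∑ j ∈ range N, z ^ j / (j.factorial * (l + j))) (fun N => by fun_prop)
    (tendsto_pi_nhds.2 fun z => ((summable_mellinExp hl z).hasSum.tendsto_sum_nat))

theorem mellinExp_eq {l : ℂ} (hl : ∀ t : ℕ, l + t ≠ 0) (z : ℂ) :
    mellinExp l z = (Complex.exp z - z * mellinExp (l + 1) z) / l := by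
  have hl0 : l ≠ 0 := by simpa using hl 0
  have hl1 : ∀ t : ℕ, l + 1 + t ≠ 0 := fun t => by
    have := hl (t + 1)
    push_cast at this
    rwa [add_assoc, add_comm 1]
  rw [eq_div_iff hl0, mellinExp, mellinExp, ← tsum_mul_right, ← tsum_mul_left,
    (((summable_mellinExp hl z).mul_right l)).tsum_eq_zero_add,
    Complex.exp_eq_exp_ℂ, NormedSpace.exp_eq_tsum_div]
  beta_reduce
  rw [(NormedSpace.expSeries_div_summable z).tsum_eq_zero_add, add_sub_assoc, ← Summable.tsum_sub]
  · congr 1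
    · simp [hl0]
    · refine tsum_congr fun j => ?_
      have h1 := hl (j + 1)
      have h2 := hl1 j
      have h3 : l + 1 + j = l + (j + 1 : ℕ) := by push_cast; ring
      rw [h3, Nat.factorial_succ]
      have h4 : (j.factorial : ℂ) ≠ 0 := Nat.cast_ne_zero.2 j.factorial_ne_zero
      have h5 : ((j + 1 : ℕ) : ℂ) ≠ 0 := Nat.cast_ne_zero.2 j.succ_ne_zero
      push_cast at *
      field_simp
      ring
  · exact (summable_nat_add_iff 1).2 (NormedSpace.expSeries_div_summable z)
  · exact (summable_mellinExp hl1 z).mul_left z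

theorem add_natCast_ne_zero_of_re_pos {l : ℂ} (hl : 0 < l.re) (t : ℕ) : l + t ≠ 0 := by
  intro h
  have := congrArg Complex.re h
  simp at this
  have : (0 : ℝ) ≤ t := t.cast_nonneg
  linarith

theorem integrableOn_cpow_sub_one {l : ℂ} (hl : 0 < l.re) :
    IntegrableOn (fun x : ℝ => (x : ℂ) ^ (l - 1)) (Set.Ioc 0 1) := by
  rw [← intervalIntegrable_iff_integrableOn_Ioc_of_le zero_le_one]
  exact intervalIntegral.intervalIntegrable_cpow' (by simpa using hl)

theorem mellinExp_eq_integral {l : ℂ} (hl : 0 < l.re) (z : ℂ) :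
    mellinExp l z = ∫ x : ℝ in Set.Ioc 0 1, (x : ℂ) ^ (l - 1) * Complex.exp (z * x) := by
  have hterm : ∀ j : ℕ, ∫ x : ℝ in Set.Ioc 0 1, (x : ℂ) ^ (l - 1) * ((z * x) ^ j / j.factorial) =
      z ^ j / (j.factorial * (l + j)) := by
    intro j
    have hlj : 0 < (l + j).re := by simp; positivity
    have hlj0 : l + j ≠ 0 := add_natCast_ne_zero_of_re_pos hl j
    calc ∫ x : ℝ in Set.Ioc 0 1, (x : ℂ) ^ (l - 1) * ((z * x) ^ j / j.factorial)
        = ∫ x : ℝ in Set.Ioc 0 1, z ^ j / j.factorial * (x : ℂ) ^ (l + j - 1) := by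
          refine setIntegral_congr_fun measurableSet_Ioc fun x hx => ?_
          have hx0 : (x : ℂ) ≠ 0 := by exact_mod_cast hx.1.ne'
          rw [show l + j - 1 = (l - 1) + j by ring, Complex.cpow_add _ _ hx0, Complex.cpow_natCast,
            mul_pow]
          ring
      _ = _ := by
          rw [integral_const_mul, ← intervalIntegral.integral_of_le zero_le_one,
            integral_cpow (Or.inl (by simpa using hlj))]
          simp [hlj0, ← div_eq_mul_inv, div_div]
  have hsum := hasSum_integral_of_summable_integral_norm
    (μ := volume.restrict (Set.Ioc (0 : ℝ) 1))
    (F := fun (j : ℕ) (x : ℝ) => (x : ℂ) ^ (l - 1) * ((z * x) ^ j / j.factorial)) ?_ ?_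
  · simp only [hterm] at hsum
    rw [mellinExp, hsum.tsum_eq]
    congr 1 with x
    rw [tsum_mul_left, Complex.exp_eq_exp_ℂ, NormedSpace.exp_eq_tsum_div]
  all_goals
    have hle : ∀ (j : ℕ), ∀ᵐ x : ℝ ∂(volume.restrict (Set.Ioc 0 1)),
        ‖(x : ℂ) ^ (l - 1) * ((z * x) ^ j / j.factorial)‖ ≤
          ‖z‖ ^ j / j.factorial * ‖(x : ℂ) ^ (l - 1)‖ := fun j => by
      refine (ae_restrict_mem measurableSet_Ioc).mono fun x hx => ?_
      rw [norm_mul, mul_comm, norm_div, norm_pow, norm_mul, Complex.norm_natCast, Complex.norm_real,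
        Real.norm_of_nonneg hx.1.le]
      gcongr
      · exact mul_nonneg (norm_nonneg _) hx.1.le
      · exact mul_le_of_le_one_right (norm_nonneg _) hx.2
    have hint : ∀ j : ℕ, Integrable (fun x : ℝ => (x : ℂ) ^ (l - 1) * ((z * x) ^ j / j.factorial))
        (volume.restrict (Set.Ioc 0 1)) := fun j =>
      ((integrableOn_cpow_sub_one hl).norm.const_mul _).mono'
        ((integrableOn_cpow_sub_one hl).aestronglyMeasurable.mul
          (by fun_prop : Continuous fun x : ℝ => (z * x) ^ j / (j.factorial : ℂ)
            ).aestronglyMeasurable) (hle j)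
  · exact hint
  · refine .of_nonneg_of_le (fun j => integral_nonneg fun x => norm_nonneg _) (fun j => ?_)
      ((summable_pow_div_factorial ‖z‖).mul_right
        (∫ x : ℝ in Set.Ioc 0 1, ‖(x : ℂ) ^ (l - 1)‖))
    rw [← integral_const_mul]
    exact integral_mono_ae (hint j).norm ((integrableOn_cpow_sub_one hl).norm.const_mul _) (hle j)

theorem norm_mellinExp_le_of_re_pos {l : ℂ} (hl : 0 < l.re) (ω : ℝ) :
    ‖mellinExp l (ω * Complex.I)‖ ≤ 1 / l.re := by
  rw [mellinExp_eq_integral hl]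
  calc ‖∫ x : ℝ in Set.Ioc 0 1, (x : ℂ) ^ (l - 1) * Complex.exp (ω * Complex.I * x)‖
      ≤ ∫ x : ℝ in Set.Ioc 0 1, ‖(x : ℂ) ^ (l - 1) * Complex.exp (ω * Complex.I * x)‖ :=
        norm_integral_le_integral_norm _
    _ = ∫ x : ℝ in Set.Ioc 0 1, x ^ (l.re - 1) := by
        refine setIntegral_congr_fun measurableSet_Ioc fun x hx => ?_
        simp [Complex.norm_exp, Complex.norm_cpow_eq_rpow_re_of_pos hx.1]
    _ = 1 / l.re := by
        rw [← intervalIntegral.integral_of_le zero_le_one, integral_rpow (Or.inl (by linarith))]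
        simp [hl.ne']

theorem exists_norm_mellinExp_le (N : ℕ) {l : ℂ} (hl : ∀ t : ℕ, l + t ≠ 0) (hN : 0 < l.re + N) :
    ∃ C : ℝ, ∀ᶠ l' in 𝓝 l, ∀ ω : ℝ,
      ‖mellinExp l' (ω * Complex.I)‖ ≤ C * (1 + |ω|) ^ N := by
  induction N generalizing l with
  | zero =>
    simp only [Nat.cast_zero, add_zero] at hN
    refine ⟨2 / l.re, ?_⟩
    filter_upwards [Complex.continuous_re.continuousAt.eventually_const_le (half_lt_self hN)]
      with l' hl' ω
    refine (norm_mellinExp_le_of_re_pos (by linarith) ω).trans ?_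
    rw [pow_zero, mul_one, div_le_div_iff₀ (by linarith) hN]
    linarith
  | succ N ih =>
    have hl1 : ∀ t : ℕ, l + 1 + t ≠ 0 := fun t => by
      have := hl (t + 1)
      push_cast at this
      rwa [add_assoc, add_comm 1]
    obtain ⟨C, hC⟩ := ih hl1 (by push_cast at hN; simp; linarith)
    obtain ⟨δ, hδ, h⟩ := exists_pos_forall_le_norm_add_natCast hl
    have hshift : Tendsto (fun l' : ℂ => l' + 1) (𝓝 l) (𝓝 (l + 1)) :=
      (continuous_id.add continuous_const).tendsto l
    refine ⟨(1 + C) / δ, ?_⟩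
    filter_upwards [ball_mem_nhds l hδ, hshift.eventually hC] with l' hl' hC' ω
    have hne : ∀ t : ℕ, l' + t ≠ 0 := fun t => norm_pos_iff.1 (hδ.trans_le (h l' hl' t))
    rw [mellinExp_eq hne, norm_div, div_mul_eq_mul_div]
    have hnum : ‖Complex.exp (ω * Complex.I) - ω * Complex.I * mellinExp (l' + 1) (ω * Complex.I)‖ ≤
        (1 + C) * (1 + |ω|) ^ (N + 1) := by
      have h1 : (1 : ℝ) ≤ (1 + |ω|) ^ (N + 1) := one_le_pow₀ (by simp)
      have h2 := hC' ω
      have h3 : |ω| * ‖mellinExp (l' + 1) (ω * Complex.I)‖ ≤ (1 + |ω|) * (C * (1 + |ω|) ^ N) :=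
        mul_le_mul (by linarith) h2 (norm_nonneg _) (by positivity)
      calc _ ≤ ‖Complex.exp (ω * Complex.I)‖ +
            ‖ω * Complex.I * mellinExp (l' + 1) (ω * Complex.I)‖ := norm_sub_le _ _
        _ = 1 + |ω| * ‖mellinExp (l' + 1) (ω * Complex.I)‖ := by
            rw [Complex.norm_exp_ofReal_mul_I, norm_mul, norm_mul]; simp
        _ ≤ _ := by rw [pow_succ] at *; linarith
    have hpos : 0 ≤ (1 + C) * (1 + |ω|) ^ (N + 1) := (norm_nonneg _).trans hnum
    have hl0 : δ ≤ ‖l'‖ := by simpa using h l' hl' 0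
    gcongr

/-- The meromorphic continuation in `l` of `∫ x in (-1, 1), |x| ^ (l - 1) * exp (2πiξx)`. -/
noncomputable def absMellinFourier (l : ℂ) (ξ : ℝ) : ℂ :=
  mellinExp l ((2 * π * ξ : ℝ) * Complex.I) + mellinExp l ((-(2 * π * ξ) : ℝ) * Complex.I)

theorem differentiableAt_absMellinFourier {l : ℂ} (hl : ∀ t : ℕ, l + t ≠ 0) (ξ : ℝ) :
    DifferentiableAt ℂ (fun l => absMellinFourier l ξ) l :=
  (differentiableAt_mellinExp hl _).add (differentiableAt_mellinExp hl _)

theorem measurable_absMellinFourier {l : ℂ} (hl : ∀ t : ℕ, l + t ≠ 0) :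
    Measurable (absMellinFourier l) := by
  have := measurable_mellinExp hl
  unfold absMellinFourier
  fun_prop

theorem exists_norm_absMellinFourier_le {l : ℂ} (hl : ∀ t : ℕ, l + t ≠ 0) :
    ∃ (N : ℕ) (C : ℝ), ∀ᶠ l' in 𝓝 l, ∀ ξ : ℝ, ‖absMellinFourier l' ξ‖ ≤ C * (1 + |ξ|) ^ N := by
  obtain ⟨N, hN⟩ := exists_nat_gt (-l.re)
  obtain ⟨C, hC⟩ := exists_norm_mellinExp_le N hl (by linarith)
  refine ⟨N, 2 * C * (2 * π) ^ N, ?_⟩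
  filter_upwards [hC] with l' hl' ξ
  have hC0 : 0 ≤ C := by simpa using (norm_nonneg _).trans (hl' 0)
  have hpow : (1 + |2 * π * ξ|) ^ N ≤ (2 * π) ^ N * (1 + |ξ|) ^ N := by
    rw [← mul_pow, abs_mul, abs_of_pos two_pi_pos, mul_add, mul_one]
    have := pi_gt_three
    gcongr
    linarith
  have h1 := hl' (2 * π * ξ)
  have h2 := hl' (-(2 * π * ξ))
  rw [abs_neg] at h2
  calc _ ≤ _ := norm_add_le _ _
    _ ≤ 2 * (C * (1 + |2 * π * ξ|) ^ N) := by linarith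
    _ ≤ 2 * (C * ((2 * π) ^ N * (1 + |ξ|) ^ N)) := by gcongr
    _ = _ := by ring

/-- `|x| ^ (l - 1)` cut off to `(-1, 1)`. -/
noncomputable def absCpowCutoff (l : ℂ) (x : ℝ) : ℂ :=
  (Set.Ioo (-1) 1).indicator (fun x : ℝ => ((|x| : ℝ) : ℂ) ^ (l - 1)) x

theorem absCpowCutoff_neg (l : ℂ) (x : ℝ) : absCpowCutoff l (-x) = absCpowCutoff l x := by
  have : -x ∈ Set.Ioo (-1 : ℝ) 1 ↔ x ∈ Set.Ioo (-1 : ℝ) 1 := by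
    simp only [Set.mem_Ioo]; constructor <;> rintro ⟨h1, h2⟩ <;> constructor <;> linarith
  by_cases hx : x ∈ Set.Ioo (-1 : ℝ) 1
  · simp [absCpowCutoff, hx, this.2 hx]
  · simp [absCpowCutoff, hx, mt this.1 hx]

theorem absCpowCutoff_ae_eq (l : ℂ) : ∀ᵐ x : ℝ ∂(volume.restrict (Set.Ioi 0)),
    absCpowCutoff l x = (Set.Ioc 0 1).indicator (fun x : ℝ => (x : ℂ) ^ (l - 1)) x := by
  have h1 : ∀ᵐ x : ℝ, x ≠ 1 := by simp [ae_iff]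
  filter_upwards [ae_restrict_of_ae h1, ae_restrict_mem measurableSet_Ioi] with x hx1 (hx0 : 0 < x)
  by_cases hx : x < 1
  · rw [absCpowCutoff, Set.indicator_of_mem (Set.mem_Ioo.2 ⟨by linarith, hx⟩),
      Set.indicator_of_mem (Set.mem_Ioc.2 ⟨hx0, hx.le⟩), abs_of_pos hx0]
  · rw [absCpowCutoff, Set.indicator_of_notMem fun h => hx h.2,
      Set.indicator_of_notMem fun h => hx (h.2.lt_of_ne hx1)]

theorem integrable_absCpowCutoff {l : ℂ} (hl : 0 < l.re) : Integrable (absCpowCutoff l) := by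
  have hpos : IntegrableOn (absCpowCutoff l) (Set.Ioi 0) :=
    (((integrable_indicator_iff measurableSet_Ioc).2
      (integrableOn_cpow_sub_one hl)).integrableOn).congr
      ((absCpowCutoff_ae_eq l).mono fun x hx => hx.symm)
  have hneg : IntegrableOn (absCpowCutoff l) (Set.Iio 0) := by
    have := ((Measure.measurePreserving_neg (volume : Measure ℝ)).integrableOn_comp_preimage
      (Homeomorph.neg ℝ).measurableEmbedding (f := absCpowCutoff l) (s := Set.Ioi 0)).2 hpos
    simpa [Function.comp_def, absCpowCutoff_neg] using this
  rw [← integrableOn_univ, ← Set.Iic_union_Ioi (a := (0 : ℝ))]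
  exact ((integrableOn_Iic_iff_integrableOn_Iio (by finiteness)).2 hneg).union hpos

theorem integral_Ioi_absCpowCutoff {l : ℂ} (hl : 0 < l.re) (z : ℂ) :
    ∫ x : ℝ in Set.Ioi 0, absCpowCutoff l x * Complex.exp (z * x) = mellinExp l z := by
  have h : Set.Ioi (0 : ℝ) ∩ Set.Ioc 0 1 = Set.Ioc 0 1 :=
    Set.inter_eq_right.2 Set.Ioc_subset_Ioi_self
  rw [mellinExp_eq_integral hl, ← h, ← setIntegral_indicator measurableSet_Ioc]
  refine integral_congr_ae ((absCpowCutoff_ae_eq l).mono fun x hx => ?_)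
  by_cases h : x ∈ Set.Ioc (0 : ℝ) 1 <;> simp [hx, h]

theorem integral_absCpowCutoff_mul_exp {l : ℂ} (hl : 0 < l.re) (ξ : ℝ) :
    ∫ x : ℝ, absCpowCutoff l x * Complex.exp ((-(2 * π * ξ) : ℝ) * Complex.I * x) =
      absMellinFourier l ξ := by
  have hint : Integrable fun x : ℝ =>
      absCpowCutoff l x * Complex.exp ((-(2 * π * ξ) : ℝ) * Complex.I * x) := by
    refine (integrable_absCpowCutoff hl).mul_bdd (c := 1) ?_ (ae_of_all _ fun x => ?_)
    · exact Continuous.aestronglyMeasurable (by fun_prop)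
    · simp [Complex.norm_exp]
  rw [← intervalIntegral.integral_Iic_add_Ioi (b := 0) hint.integrableOn hint.integrableOn,
    integral_Ioi_absCpowCutoff hl, absMellinFourier]
  congr 1
  rw [← integral_Ioi_absCpowCutoff hl, ← neg_zero, ← integral_comp_neg_Ioi, neg_zero]
  refine integral_congr_ae (ae_of_all _ fun x => ?_)
  simp [absCpowCutoff_neg]

end OscillatoryMellin

section FourierDecay

open Filter Topology Metric FourierTransform RealInnerProductSpace

theorem exists_norm_le_indicator_of_isCompact {X ι : Type*} [TopologicalSpace X] [Fintype ι]
    {ψ : X → (ι → ℂ) → ℂ} {K : Set X} (hK : IsCompact K)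
    (hcont : Continuous fun q : X × (ι → ℂ) => ψ q.1 q.2)
    (hsupp : ∀ s, ∀ x ∉ K, ψ x s = 0) (s₀ : ι → ℂ) (R : ℝ) :
    ∃ M : ℝ, ∀ s ∈ closedBall s₀ R, ∀ x, ‖ψ x s‖ ≤ K.indicator (fun _ => M) x := by
  obtain ⟨M, hM⟩ := (hK.prod (isCompact_closedBall s₀ R)).exists_bound_of_continuousOn
    hcont.continuousOn
  refine ⟨M, fun s hs x => ?_⟩
  by_cases hx : x ∈ K
  · simpa [hx] using hM (x, s) ⟨hx, hs⟩
  · simp [hx, hsupp s x hx]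

variable {V ι : Type*} [NormedAddCommGroup V] [InnerProductSpace ℝ V] [FiniteDimensional ℝ V]
  [MeasurableSpace V] [BorelSpace V] [Fintype ι]

theorem HasCompactSupport.exists_norm_fourierInv_mul_pow_le {g : V → ℂ}
    (hg : ContDiff ℝ (⊤ : ℕ∞) g) (hc : HasCompactSupport g) (N : ℕ) :
    ∃ C : ℝ, ∀ ξ, ‖𝓕⁻ g ξ‖ * (1 + ‖ξ‖) ^ N ≤ C := by
  have h := SchwartzMap.one_add_le_sup_seminorm_apply (𝕜 := ℝ) (m := (N, 0)) (k := N) (n := 0)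
    le_rfl le_rfl (𝓕⁻ (hc.toSchwartzMap hg))
  simp only [norm_iteratedFDeriv_zero, SchwartzMap.fourierInv_coe] at h
  exact ⟨_, fun ξ => (mul_comm _ _).trans_le (h ξ)⟩

theorem HasCompactSupport.continuous_fourierInv {g : V → ℂ}
    (hg : ContDiff ℝ (⊤ : ℕ∞) g) (hc : HasCompactSupport g) : Continuous (𝓕⁻ g) := by
  have h := (𝓕⁻ (hc.toSchwartzMap hg)).continuous
  rw [SchwartzMap.fourierInv_coe] at h
  exact h

theorem HasCompactSupport.fourier_fourierInv_eq {g : V → ℂ}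
    (hg : ContDiff ℝ (⊤ : ℕ∞) g) (hc : HasCompactSupport g) : 𝓕 (𝓕⁻ g) = g := by
  have h : 𝓕 (𝓕⁻ (hc.toSchwartzMap hg)) = hc.toSchwartzMap hg :=
    FourierTransform.fourier_fourierInv_eq _
  have h1 := congrArg (fun f : SchwartzMap V ℂ => (f : V → ℂ)) h
  simp only [SchwartzMap.fourier_coe, SchwartzMap.fourierInv_coe] at h1
  exact h1

theorem HasCompactSupport.integrable_fourierInv {g : V → ℂ}
    (hg : ContDiff ℝ (⊤ : ℕ∞) g) (hc : HasCompactSupport g) : Integrable (𝓕⁻ g) := by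
  have h := (𝓕⁻ (hc.toSchwartzMap hg)).integrable (μ := volume)
  rw [SchwartzMap.fourierInv_coe] at h
  exact h

variable {ψ : V → (ι → ℂ) → ℂ} {K : Set V}

theorem differentiable_fourierInv_param (hK : IsCompact K)
    (hcont : Continuous fun q : V × (ι → ℂ) => ψ q.1 q.2)
    (hhol : ∀ x, Differentiable ℂ (ψ x)) (hsupp : ∀ s, ∀ x ∉ K, ψ x s = 0) (ξ : V) :
    Differentiable ℂ fun s => 𝓕⁻ (fun x => ψ x s) ξ := by
  rw [← differentiableOn_univ]
  simp only [Real.fourierInv_eq]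
  refine DifferentiableOn.integral_of_dominated isOpen_univ (fun s _ => ?_) (fun x => ?_)
    fun s₀ _ => ?_
  · have : Continuous fun x => ψ x s := hcont.comp (by fun_prop : Continuous fun x => (x, s))
    exact ((Real.continuous_fourierChar.comp
      (continuous_id.inner continuous_const)).smul this).aestronglyMeasurable
  · simp only [Circle.smul_def, smul_eq_mul]
    exact ((hhol x).const_mul _).differentiableOn
  · obtain ⟨M, hM⟩ := exists_norm_le_indicator_of_isCompact hK hcont hsupp s₀ 1
    refine ⟨K.indicator fun _ => M, ?_, ?_⟩
    · exact (integrable_indicator_iff hK.measurableSet).2 (integrableOn_const hK.measure_lt_top.ne)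
    · filter_upwards [closedBall_mem_nhds s₀ one_pos] with s hs x
      simpa [Circle.norm_smul] using hM s hs x

theorem exists_norm_fourierInv_param_le (hK : IsCompact K)
    (hcont : Continuous fun q : V × (ι → ℂ) => ψ q.1 q.2)
    (hsupp : ∀ s, ∀ x ∉ K, ψ x s = 0) (s₀ : ι → ℂ) (R : ℝ) :
    ∃ C : ℝ, ∀ ξ, ∀ s ∈ closedBall s₀ R, ‖𝓕⁻ (fun x => ψ x s) ξ‖ ≤ C := by
  obtain ⟨M, hM⟩ := exists_norm_le_indicator_of_isCompact hK hcont hsupp s₀ R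
  refine ⟨∫ x, K.indicator (fun _ => M) x, fun ξ s hs => ?_⟩
  rw [Real.fourierInv_eq]
  refine norm_integral_le_of_norm_le
    ((integrable_indicator_iff hK.measurableSet).2 (integrableOn_const hK.measure_lt_top.ne))
    (ae_of_all _ fun x => ?_)
  simpa [Circle.norm_smul] using hM s hs x

/-- The Fourier transform of a holomorphic family of test functions decays rapidly, locally
uniformly in the parameter, even when the derivatives of the family are not assumed to be
locally bounded in the parameter. -/
theorem exists_norm_fourierInv_param_mul_pow_le (hK : IsCompact K)
    (hsmooth : ∀ s, ContDiff ℝ (⊤ : ℕ∞) fun x => ψ x s)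
    (hcont : Continuous fun q : V × (ι → ℂ) => ψ q.1 q.2)
    (hhol : ∀ x, Differentiable ℂ (ψ x)) (hsupp : ∀ s, ∀ x ∉ K, ψ x s = 0)
    (s₀ : ι → ℂ) (N : ℕ) :
    ∃ C : ℝ, ∀ s ∈ closedBall s₀ 1, ∀ ξ, ‖𝓕⁻ (fun x => ψ x s) ξ‖ * (1 + ‖ξ‖) ^ N ≤ C := by
  have : (cocompact V).IsCountablyGenerated := by
    rw [← cobounded_eq_cocompact, ← comap_norm_atTop]
    infer_instance
  have hT : Tendsto (fun ξ : V => 1 + ‖ξ‖) (cocompact V) atTop :=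
    tendsto_atTop_add_const_left _ _ tendsto_norm_cocompact_atTop
  obtain ⟨C, hC⟩ := exists_norm_fourierInv_param_le hK hcont hsupp s₀ 2
  have hdecay : ∀ s, ∀ N : ℕ, ∀ᶠ ξ in cocompact V,
      ‖𝓕⁻ (fun x => ψ x s) ξ‖ * (1 + ‖ξ‖) ^ N ≤ 1 := by
    intro s N
    obtain ⟨C, hC⟩ := (HasCompactSupport.intro hK
      (hsupp s)).exists_norm_fourierInv_mul_pow_le (hsmooth s) (N + 1)
    filter_upwards [hT.eventually_ge_atTop C] with ξ hξ
    have h1 : 0 < 1 + ‖ξ‖ := by positivity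
    refine le_of_mul_le_mul_right ?_ h1
    calc _ = ‖𝓕⁻ (fun x => ψ x s) ξ‖ * (1 + ‖ξ‖) ^ (N + 1) := by ring
      _ ≤ _ := by linarith [hC ξ]
  have hev := eventually_forall_norm_mul_pow_le_one
    (f := fun ξ s => 𝓕⁻ (fun x => ψ x s) ξ)
    (differentiable_fourierInv_param hK hcont hhol hsupp) hT hC hdecay N
  obtain ⟨K', hK', hsub⟩ := mem_cocompact.1 hev
  obtain ⟨B, hB⟩ := hK'.exists_bound_of_continuousOn (f := fun ξ : V => (1 + ‖ξ‖) ^ N)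
    (by fun_prop)
  refine ⟨max 1 (C * B), fun s hs ξ => ?_⟩
  by_cases hξ : ξ ∈ K'
  · refine le_max_of_le_right ?_
    have h1 := hC ξ s (closedBall_subset_closedBall one_le_two hs)
    have h2 := (le_abs_self _).trans (hB ξ hξ)
    have h3 := (norm_nonneg _).trans h1
    gcongr
  · exact le_max_of_le_left (hsub hξ s hs)

end FourierDecay

section MonomialContinuation

open Filter Topology Metric FourierTransform RealInnerProductSpace

variable {κ ι : Type*} [Fintype κ] [Fintype ι]

theorem isOpen_setOf_forall_add_natCast_ne_zero {X : Type*} [TopologicalSpace X] {Λ : κ → X → ℂ}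
    (hΛ : ∀ i, Continuous (Λ i)) : IsOpen {s | ∀ i, ∀ t : ℕ, Λ i s + t ≠ 0} := by
  have h : IsOpen {l : ℂ | ∀ t : ℕ, l + t ≠ 0} := by
    refine isOpen_iff_mem_nhds.2 fun l hl => ?_
    obtain ⟨δ, hδ, h⟩ := exists_pos_forall_le_norm_add_natCast hl
    filter_upwards [ball_mem_nhds l hδ] with l' hl' t
    exact norm_pos_iff.1 (hδ.trans_le (h l' hl' t))
  rw [Set.ofPred_forall]
  exact isOpen_iInter_of_finite fun i => h.preimage (hΛ i)

theorem exists_norm_prod_absMellinFourier_le {X : Type*} [TopologicalSpace X] {Λ : κ → X → ℂ}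
    {s₀ : X} (hΛ : ∀ i, ContinuousAt (Λ i) s₀) (h₀ : ∀ i, ∀ t : ℕ, Λ i s₀ + t ≠ 0) :
    ∃ (N : ℕ) (C : ℝ), 0 ≤ C ∧ ∀ᶠ s in 𝓝 s₀, ∀ ξ : EuclideanSpace ℝ κ,
      ‖∏ i, absMellinFourier (Λ i s) (ξ i)‖ ≤ C * (1 + ‖ξ‖) ^ N := by
  choose N C hC using fun i => exists_norm_absMellinFourier_le (h₀ i)
  have hC0 : ∀ i, 0 ≤ C i := fun i => by
    simpa using (norm_nonneg _).trans ((hC i).self_of_nhds 0)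
  refine ⟨∑ i, N i, ∏ i, C i, Finset.prod_nonneg fun i _ => hC0 i, ?_⟩
  filter_upwards [eventually_all.2 fun i => (hΛ i).eventually (hC i)] with s hs ξ
  rw [norm_prod, ← Finset.prod_pow_eq_pow_sum, ← Finset.prod_mul_distrib]
  refine Finset.prod_le_prod (fun _ _ => norm_nonneg _) fun i _ => (hs i _).trans ?_
  have h1 : |ξ i| ≤ ‖ξ‖ := PiLp.norm_apply_le ξ i
  have := hC0 i
  gcongr

theorem differentiableOn_integral_fourierInv_mul_prod_absMellinFourier
    {ψ : EuclideanSpace ℝ κ → (ι → ℂ) → ℂ} {K : Set (EuclideanSpace ℝ κ)} {Λ : κ → (ι → ℂ) → ℂ}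
    (hK : IsCompact K) (hsmooth : ∀ s, ContDiff ℝ (⊤ : ℕ∞) fun x => ψ x s)
    (hcont : Continuous fun q : EuclideanSpace ℝ κ × (ι → ℂ) => ψ q.1 q.2)
    (hhol : ∀ x, Differentiable ℂ (ψ x)) (hsupp : ∀ s, ∀ x ∉ K, ψ x s = 0)
    (hΛ : ∀ i, Differentiable ℂ (Λ i)) :
    DifferentiableOn ℂ
      (fun s => ∫ ξ, 𝓕⁻ (fun x => ψ x s) ξ * ∏ i, absMellinFourier (Λ i s) (ξ i))
      {s | ∀ i, ∀ t : ℕ, Λ i s + t ≠ 0} := by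
  refine DifferentiableOn.integral_of_dominated
    (isOpen_setOf_forall_add_natCast_ne_zero fun i => (hΛ i).continuous) (fun s hs => ?_)
    (fun ξ => ?_) fun s₀ hs₀ => ?_
  · have hG := (HasCompactSupport.intro hK (hsupp s)).continuous_fourierInv (hsmooth s)
    refine hG.aestronglyMeasurable.mul (Measurable.aestronglyMeasurable ?_)
    exact Finset.measurable_fun_prod _ fun i _ =>
      (measurable_absMellinFourier (hs i)).comp (by fun_prop)
  · refine (differentiable_fourierInv_param hK hcont hhol hsupp ξ).differentiableOn.mul ?_
    classical
    exact fun s hs => (HasFDerivAt.finsetProd fun i _ =>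
      ((differentiableAt_absMellinFourier (hs i) (ξ i)).comp s
        (hΛ i s)).hasFDerivAt).differentiableAt.differentiableWithinAt
  · obtain ⟨N, C, hC0, hC⟩ := exists_norm_prod_absMellinFourier_le
      (fun i => (hΛ i).continuous.continuousAt) hs₀
    obtain ⟨B, hB⟩ := exists_norm_fourierInv_param_mul_pow_le hK hsmooth hcont hhol hsupp s₀
      (N + (Module.finrank ℝ (EuclideanSpace ℝ κ) + 1))
    refine ⟨fun ξ => C * B * (1 + ‖ξ‖) ^ (-((Module.finrank ℝ (EuclideanSpace ℝ κ) + 1 : ℕ) : ℝ)),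
      (integrable_one_add_norm (by push_cast; linarith)).const_mul _, ?_⟩
    filter_upwards [hC, closedBall_mem_nhds s₀ one_pos] with s hs hs1 ξ
    have hT : 0 < 1 + ‖ξ‖ := by positivity
    rw [norm_mul, Real.rpow_neg hT.le, Real.rpow_natCast, ← div_eq_mul_inv, le_div_iff₀ (by positivity)]
    generalize Module.finrank ℝ (EuclideanSpace ℝ κ) + 1 = d at *
    calc _ ≤ ‖𝓕⁻ (fun x => ψ x s) ξ‖ * (C * (1 + ‖ξ‖) ^ N) * (1 + ‖ξ‖) ^ d := by
          gcongr
          exact hs ξ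
      _ = C * (‖𝓕⁻ (fun x => ψ x s) ξ‖ * (1 + ‖ξ‖) ^ (N + d)) := by ring
      _ ≤ C * B := by
          gcongr
          exact hB s hs1 ξ

theorem integrable_prod_absCpowCutoff {l : κ → ℂ} (hl : ∀ i, 0 < (l i).re) :
    Integrable fun y : EuclideanSpace ℝ κ => ∏ i, absCpowCutoff (l i) (y i) := by
  have h : Integrable fun y : κ → ℝ => ∏ i, absCpowCutoff (l i) (y i) :=
    Integrable.fintype_prod fun i => integrable_absCpowCutoff (hl i)
  exact ((PiLp.volume_preserving_ofLp κ).integrable_comp_emb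
    (MeasurableEquiv.toLp 2 (κ → ℝ)).symm.measurableEmbedding).2 h

theorem fourier_prod_absCpowCutoff {l : κ → ℂ} (hl : ∀ i, 0 < (l i).re)
    (ξ : EuclideanSpace ℝ κ) :
    𝓕 (fun y : EuclideanSpace ℝ κ => ∏ i, absCpowCutoff (l i) (y i)) ξ =
      ∏ i, absMellinFourier (l i) (ξ i) := by
  simp only [← fun i => integral_absCpowCutoff_mul_exp (hl i) (ξ i)]
  rw [Real.fourier_eq', ← integral_fintype_prod_volume_eq_prod, ←
    (PiLp.volume_preserving_ofLp κ).integral_comp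
      (MeasurableEquiv.toLp 2 (κ → ℝ)).symm.measurableEmbedding]
  refine integral_congr_ae (ae_of_all _ fun y => ?_)
  simp only [smul_eq_mul, Finset.prod_mul_distrib, ← Complex.exp_sum]
  rw [mul_comm]
  congr 2
  simp only [PiLp.inner_apply, RCLike.inner_apply, conj_trivial, Finset.mul_sum, Finset.sum_mul,
    Complex.ofReal_sum, Complex.ofReal_mul, Complex.ofReal_neg]
  refine Finset.sum_congr rfl fun i _ => ?_
  push_cast
  ring

theorem integral_fourierInv_mul_prod_absMellinFourier {g : EuclideanSpace ℝ κ → ℂ}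
    (hg : ContDiff ℝ (⊤ : ℕ∞) g) (hc : HasCompactSupport g) {l : κ → ℂ}
    (hl : ∀ i, 0 < (l i).re) :
    ∫ ξ, 𝓕⁻ g ξ * ∏ i, absMellinFourier (l i) (ξ i) =
      ∫ y, g y * ∏ i, absCpowCutoff (l i) (y i) := by
  have h := VectorFourier.integral_fourierIntegral_smul_eq_flip (L := innerₗ (EuclideanSpace ℝ κ))
    (μ := volume) (ν := volume) Real.continuous_fourierChar continuous_inner
    (hc.integrable_fourierInv hg) (integrable_prod_absCpowCutoff hl)
  rw [flip_innerₗ] at h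
  change ∫ ξ, 𝓕 (𝓕⁻ g) ξ • (∏ i, absCpowCutoff (l i) (ξ i)) = ∫ ξ, 𝓕⁻ g ξ •
    𝓕 (fun y : EuclideanSpace ℝ κ => ∏ i, absCpowCutoff (l i) (y i)) ξ at h
  simp only [hc.fourier_fourierInv_eq hg, fourier_prod_absCpowCutoff hl, smul_eq_mul] at h
  exact h.symm

end MonomialContinuation

/-- Meromorphic continuation of monomial integrals: under the hypotheses of the monomial
lemma, if `ℛ ≠ ∅` then there is a holomorphic function `F` on `ℂᵐ ∖ P` agreeing with the
integral `J(s)` on `ℛ ∖ P`; i.e. `J` continues analytically to `ℂᵐ` as a meromorphic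
function with poles contained in `P`. -/
theorem monomial_integral_meromorphic_continuation (n m r : ℕ)
    (hn : 1 ≤ n) (hm : 1 ≤ m) (hr : 1 ≤ r) (hrn : r ≤ n)
    (a : Fin r → Fin m → ℤ) (ha : ∀ i, ∃ j, a i j ≠ 0) (b : Fin r → ℤ)
    (Φ : (Fin n → ℝ) → (Fin m → ℂ) → ℂ)
    (hΦsmooth : ∀ s, ContDiff ℝ (⊤ : ℕ∞) (fun y => Φ y s))
    (hΦsupp : ∀ s, tsupport (fun y => Φ y s) ⊆ {y : Fin n → ℝ | ∀ i, |y i| < 1})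
    (hΦhol : ∀ y, Differentiable ℂ (fun s => Φ y s))
    (hΦcont : Continuous fun q : (Fin n → ℝ) × (Fin m → ℂ) => Φ q.1 q.2)
    (hR : (monomialRegion m r a b).Nonempty) :
    ∃ F : (Fin m → ℂ) → ℂ,
      DifferentiableOn ℂ F (monomialPolarLocus m r a b)ᶜ ∧
      ∀ s ∈ monomialRegion m r a b \ monomialPolarLocus m r a b,
        F s = ∫ y, monomialIntegrand n m r hrn a b Φ s y := by
  classical
  let Λ : Fin n → (Fin m → ℂ) → ℂ := fun i s =>
    if h : i.val < r then (∑ j, (a ⟨i, h⟩ j : ℂ) * s j) + (b ⟨i, h⟩ : ℂ) else 1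
  have hΛr : ∀ (i : Fin r) s, Λ (Fin.castLE hrn i) s = (∑ j, (a i j : ℂ) * s j) + (b i : ℂ) :=
    fun i s => by simp [Λ]
  have hΛ1 : ∀ i s, i ∉ Set.range (Fin.castLE hrn) → Λ i s = 1 := fun i s hi =>
    dif_neg fun h => hi ⟨⟨i, h⟩, rfl⟩
  have hcases : ∀ {p : Fin n → Prop}, (∀ i, p (Fin.castLE hrn i)) →
      (∀ i ∉ Set.range (Fin.castLE hrn), p i) → ∀ i, p i := fun h1 h2 i => by
    by_cases hi : i ∈ Set.range (Fin.castLE hrn)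
    · obtain ⟨i, rfl⟩ := hi
      exact h1 i
    · exact h2 i hi
  have hΛdiff : ∀ i, Differentiable ℂ (Λ i) := by
    refine hcases (fun i => ?_) fun i hi => ?_
    · rw [funext (hΛr i)]
      fun_prop
    · rw [funext fun s => hΛ1 i s hi]
      fun_prop
  have hne : (monomialPolarLocus m r a b)ᶜ ⊆ {s | ∀ i, ∀ t : ℕ, Λ i s + t ≠ 0} := by
    intro s hs
    refine hcases (fun i t h => hs ?_) fun i hi t => ?_
    · rw [hΛr] at h
      exact Set.mem_iUnion.2 ⟨i, Set.mem_iUnion.2 ⟨t, h⟩⟩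
    · rw [hΛ1 i s hi]
      exact_mod_cast (by omega : 1 + t ≠ 0)
  have hzero : ∀ s y, y ∉ {y : Fin n → ℝ | ∀ i, |y i| < 1} → Φ y s = 0 := fun s y hy =>
    image_eq_zero_of_notMem_tsupport (f := fun y => Φ y s) fun h => hy (hΦsupp s h)
  let ψ : EuclideanSpace ℝ (Fin n) → (Fin m → ℂ) → ℂ := fun x s => Φ x.ofLp s
  let K : Set (EuclideanSpace ℝ (Fin n)) := WithLp.toLp 2 '' Set.univ.pi fun _ => Set.Icc (-1) 1
  have hK : IsCompact K :=
    (isCompact_univ_pi fun _ => isCompact_Icc).image (PiLp.continuous_toLp 2 _)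
  have hsmooth : ∀ s, ContDiff ℝ (⊤ : ℕ∞) fun x => ψ x s := fun s =>
    (hΦsmooth s).comp PiLp.contDiff_ofLp
  have hsupp : ∀ s, ∀ x ∉ K, ψ x s = 0 := fun s x hx => hzero s _ fun h =>
    hx ⟨x.ofLp, fun i _ => abs_le.1 (h i).le, rfl⟩
  refine ⟨_, (differentiableOn_integral_fourierInv_mul_prod_absMellinFourier hK hsmooth
    (hΦcont.comp (((PiLp.continuous_ofLp 2 _).comp continuous_fst).prodMk continuous_snd))
    (fun x => hΦhol x.ofLp) hsupp hΛdiff).mono hne, fun s hs => ?_⟩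
  have hre : ∀ i, 0 < (Λ i s).re := by
    refine hcases (fun i => ?_) fun i hi => ?_
    · have := hs.1 i
      rw [hΛr]
      simpa using this
    · simp [hΛ1 i s hi]
  rw [integral_fourierInv_mul_prod_absMellinFourier (hsmooth s)
    (HasCompactSupport.intro hK (hsupp s)) hre, ← (PiLp.volume_preserving_toLp _).integral_comp
      (MeasurableEquiv.toLp 2 (Fin n → ℝ)).measurableEmbedding]
  refine integral_congr_ae (Filter.Eventually.of_forall fun y => ?_)
  by_cases hy : y ∈ {y : Fin n → ℝ | ∀ i, |y i| < 1}
  · have hcut : ∀ i, absCpowCutoff (Λ i s) (y i) = ((|y i| : ℝ) : ℂ) ^ (Λ i s - 1) := fun i =>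
      Set.indicator_of_mem (Set.mem_Ioo.2 (abs_lt.1 (hy i))) _
    simp only [ψ, monomialIntegrand, hcut]
    congr 1
    symm
    refine Fintype.prod_of_injective (Fin.castLE hrn) (Fin.castLE_injective hrn) _ _
      (fun i hi => ?_) fun i => ?_
    · simp [hΛ1 i s hi]
    · rw [hΛr]
  · simp [ψ, monomialIntegrand, hzero s y hy]
end

section
/- Let N ≥ 1 and v ≥ 1 be integers and let θ : ℝ → ℂ be a Schwartz function. Then there exists an entire function B : ℂ → ℂ such that for every s ∈ ℂ with Re(s) > −v/N, ∫_ℝ θ(y) |y|^{N s + v − 1} dy = Γ(N s + v) · B(s), where Γ is the Gamma function. -/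
open MeasureTheory

open Set Filter Topology Asymptotics in
/-- The Mellin transform of a Schwartz function converges, and is complex differentiable, on the
right half-plane. -/
theorem SchwartzMap.mellinConvergent_and_differentiableAt (φ : SchwartzMap ℝ ℂ) {z : ℂ}
    (hz : 0 < z.re) : MellinConvergent φ z ∧ DifferentiableAt ℂ (mellin φ) z := by
  have hloc : LocallyIntegrableOn φ (Ioi 0) :=
    φ.continuous.locallyIntegrable.locallyIntegrableOn _
  have htop : φ =O[atTop] (· ^ (-(z.re + 1)) : ℝ → ℝ) := by
    refine ((φ.isBigO_cocompact_rpow (-(z.re + 1))).mono atTop_le_cocompact).congr' .rfl ?_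
    filter_upwards [eventually_ge_atTop 0] with x hx
    rw [Real.norm_of_nonneg hx]
  have hbot : φ =O[𝓝[>] 0] (· ^ (-(0 : ℝ)) : ℝ → ℝ) := by
    simpa using (φ.continuous.continuousAt.isBigO_one ℝ).mono nhdsWithin_le_nhds
  exact ⟨mellinConvergent_of_isBigO_rpow hloc htop (lt_add_one _) hbot hz,
    mellin_differentiableAt_of_isBigO_rpow hloc htop (lt_add_one _) hbot hz⟩

open Set Filter Topology Asymptotics in
/-- Integration by parts for the Mellin transform of a Schwartz function. -/
theorem SchwartzMap.mul_mellin_eq_mellin_neg_deriv (φ : SchwartzMap ℝ ℂ) {z : ℂ}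
    (hz : 0 < z.re) :
    z * mellin φ z = mellin (-SchwartzMap.derivCLM ℂ ℂ φ : SchwartzMap ℝ ℂ) (z + 1) := by
  have hz0 : z ≠ 0 := by rintro rfl; simp at hz
  have hz1 : 0 < (z + 1).re := by simp; linarith
  have hzero : Tendsto ((φ : ℝ → ℂ) * fun x : ℝ => (x : ℂ) ^ z) (𝓝[>] 0) (𝓝 0) := by
    have h : ContinuousAt ((φ : ℝ → ℂ) * fun x : ℝ => (x : ℂ) ^ z) 0 :=
      φ.continuous.continuousAt.mul (Complex.continuousAt_ofReal_cpow_const 0 z (Or.inl hz))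
    simpa [ContinuousAt, Complex.zero_cpow hz0] using h.mono_left nhdsWithin_le_nhds
  have htop : Tendsto ((φ : ℝ → ℂ) * fun x : ℝ => (x : ℂ) ^ z) atTop (𝓝 0) := by
    have h : (fun x : ℝ => φ x * (x : ℂ) ^ z) =O[atTop] fun x : ℝ => x⁻¹ := by
      have h1 := (φ.isBigO_cocompact_rpow (-(z.re + 1))).mono atTop_le_cocompact
      have h2 : (fun x : ℝ => (x : ℂ) ^ z) =O[atTop] fun x : ℝ => x ^ z.re := by
        refine IsBigO.of_bound 1 ?_
        filter_upwards [eventually_gt_atTop 0] with x hx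
        rw [Complex.norm_cpow_eq_rpow_re_of_pos hx, one_mul]
        exact le_abs_self _
      refine (h1.mul h2).congr' .rfl ?_
      filter_upwards [eventually_gt_atTop 0] with x hx
      rw [Real.norm_of_nonneg hx.le, ← Real.rpow_add hx, ← Real.rpow_neg_one]
      congr 1; ring
    exact h.trans_tendsto tendsto_inv_atTop_zero
  have hint := (φ.mellinConvergent_and_differentiableAt hz).1
  have hint' :=
    ((-SchwartzMap.derivCLM ℂ ℂ φ : SchwartzMap ℝ ℂ).mellinConvergent_and_differentiableAt hz1).1
  have key := integral_Ioi_mul_deriv_eq_deriv_mul (a := 0) (u := φ) (u' := deriv φ)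
    (v := fun x : ℝ => (x : ℂ) ^ z) (v' := fun x : ℝ => z * (x : ℂ) ^ (z - 1))
    (fun x _ => φ.hasDerivAt x) (fun x hx => hasDerivAt_ofReal_cpow_const (ne_of_gt hx) hz0)
    ?_ ?_ hzero htop
  · rw [sub_zero, zero_sub, ← integral_neg] at key
    rw [mellin, mellin, ← integral_const_mul]
    refine Eq.trans ?_ (key.trans ?_)
    · exact integral_congr_ae (.of_forall fun x => by simp only [smul_eq_mul]; ring)
    · exact integral_congr_ae
        (.of_forall fun x => by simp [SchwartzMap.derivCLM_apply, mul_comm])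
  · refine (hint.const_mul z).congr (.of_forall fun x => ?_)
    simp only [smul_eq_mul, Pi.mul_apply]; ring
  · refine hint'.neg.congr (.of_forall fun x => ?_)
    simp [SchwartzMap.derivCLM_apply, mul_comm]

/-- The Mellin transform of the `n`-th derivative of `φ` (up to sign), shifted by `n` and divided
by the Gamma function: the representation on `Re z > -n` of the continuation of
`mellin φ z / Γ z`. -/
noncomputable def mellinDivGamma (φ : SchwartzMap ℝ ℂ) (n : ℕ) (z : ℂ) : ℂ :=
  mellin ((fun ψ : SchwartzMap ℝ ℂ => -SchwartzMap.derivCLM ℂ ℂ ψ)^[n] φ) (z + n) *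
    (Complex.Gamma (z + n))⁻¹

theorem mellinDivGamma_succ (φ : SchwartzMap ℝ ℂ) (n : ℕ) {z : ℂ} (hz : 0 < (z + n).re) :
    mellinDivGamma φ (n + 1) z = mellinDivGamma φ n z := by
  have hz0 : z + n ≠ 0 := by intro h; simp [h] at hz
  have hΓ := Complex.Gamma_ne_zero_of_re_pos hz
  rw [mellinDivGamma, mellinDivGamma, Function.iterate_succ_apply', Nat.cast_succ, ← add_assoc,
    ← SchwartzMap.mul_mellin_eq_mellin_neg_deriv _ hz, Complex.Gamma_add_one _ hz0]
  field_simp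

theorem mellinDivGamma_eq_of_le (φ : SchwartzMap ℝ ℂ) {m n : ℕ} (hmn : m ≤ n) {z : ℂ}
    (hz : 0 < (z + m).re) : mellinDivGamma φ n z = mellinDivGamma φ m z := by
  induction n, hmn using Nat.le_induction with
  | base => rfl
  | succ n hmn ih =>
    rw [mellinDivGamma_succ, ih]
    have : (m : ℝ) ≤ n := by exact_mod_cast hmn
    simp at hz ⊢
    linarith

theorem differentiableAt_mellinDivGamma (φ : SchwartzMap ℝ ℂ) (n : ℕ) {z : ℂ}
    (hz : 0 < (z + n).re) : DifferentiableAt ℂ (mellinDivGamma φ n) z := by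
  have hadd : DifferentiableAt ℂ (fun z : ℂ => z + n) z := by fun_prop
  exact (DifferentiableAt.fun_comp' z
    (SchwartzMap.mellinConvergent_and_differentiableAt _ hz).2 hadd).mul
    (DifferentiableAt.fun_comp' (g := fun s => (Complex.Gamma s)⁻¹) z
      (Complex.differentiable_one_div_Gamma _) hadd)

/-- The quotient of the Mellin transform of a Schwartz function by the Gamma function extends to an
entire function. -/
theorem SchwartzMap.exists_entire_mellin_eq_Gamma_mul (φ : SchwartzMap ℝ ℂ) :
    ∃ E : ℂ → ℂ, Differentiable ℂ E ∧
      ∀ z : ℂ, 0 < z.re → mellin φ z = Complex.Gamma z * E z := by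
  have hfloor (z : ℂ) : 0 < (z + (⌊-z.re⌋₊ + 1 : ℕ)).re := by
    have := Nat.lt_floor_add_one (-z.re)
    simp
    linarith
  refine ⟨fun z => mellinDivGamma φ (⌊-z.re⌋₊ + 1) z, fun z => ?_, fun z hz => ?_⟩
  · have hopen : IsOpen {w : ℂ | 0 < (w + (⌊-z.re⌋₊ + 1 : ℕ)).re} :=
      isOpen_lt continuous_const (by fun_prop)
    refine (differentiableAt_mellinDivGamma φ _ (hfloor z)).congr_of_eventuallyEq ?_
    filter_upwards [hopen.mem_nhds (hfloor z)] with w hw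
    rcases le_total (⌊-z.re⌋₊ + 1) (⌊-w.re⌋₊ + 1) with h | h
    · exact mellinDivGamma_eq_of_le φ h hw
    · exact (mellinDivGamma_eq_of_le φ h (hfloor w)).symm
  · have hΓ := Complex.Gamma_ne_zero_of_re_pos hz
    simp only [mellinDivGamma_eq_of_le φ (Nat.zero_le _) (z := z) (by simpa using hz)]
    simp [mellinDivGamma]
    field_simp

open Set in
/-- The integral of a Schwartz function against `|y| ^ (w - 1)` over the line is the sum of the
Mellin transforms of the function and of its reflection. -/
theorem SchwartzMap.integral_mul_abs_cpow (θ : SchwartzMap ℝ ℂ) {w : ℂ} (hw : 0 < w.re) :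
    ∫ y : ℝ, θ y * ((|y| : ℝ) : ℂ) ^ (w - 1) =
      mellin θ w + mellin (SchwartzMap.compCLMOfContinuousLinearEquiv ℂ
        (ContinuousLinearEquiv.neg ℝ : ℝ ≃L[ℝ] ℝ) θ) w := by
  set θ' := SchwartzMap.compCLMOfContinuousLinearEquiv ℂ
    (ContinuousLinearEquiv.neg ℝ : ℝ ≃L[ℝ] ℝ) θ with hθ'
  set g : ℝ → ℂ := fun y => θ y * ((|y| : ℝ) : ℂ) ^ (w - 1) with hg
  have hpos : EqOn (fun t : ℝ => (t : ℂ) ^ (w - 1) • θ t) g (Ioi 0) := fun t ht => by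
    simp [hg, abs_of_pos (mem_Ioi.mp ht), mul_comm]
  have hneg : EqOn (fun t : ℝ => (t : ℂ) ^ (w - 1) • θ' t) (fun t => g (-t)) (Ioi 0) :=
    fun t ht => by simp [hg, hθ', abs_of_pos (mem_Ioi.mp ht), mul_comm]
  have hright : IntegrableOn g (Ioi 0) :=
    (integrableOn_congr_fun hpos measurableSet_Ioi).mp
      (θ.mellinConvergent_and_differentiableAt hw).1
  have hleft : IntegrableOn g (Iic 0) := by
    have h : IntegrableOn (fun t => g (-t)) (Ioi 0) :=
      (integrableOn_congr_fun hneg measurableSet_Ioi).mp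
        (θ'.mellinConvergent_and_differentiableAt hw).1
    rw [integrableOn_Iic_iff_integrableOn_Iio,
      ← (Measure.measurePreserving_neg (volume : Measure ℝ)).integrableOn_comp_preimage
        (Homeomorph.neg ℝ).measurableEmbedding]
    simpa [Function.comp_def] using h
  rw [← intervalIntegral.integral_Iic_add_Ioi hleft hright, add_comm, mellin, mellin,
    setIntegral_congr_fun measurableSet_Ioi hpos, setIntegral_congr_fun measurableSet_Ioi hneg,
    integral_comp_neg_Ioi, neg_zero]

/-- For integers `N ≥ 1`, `v ≥ 1` and a Schwartz function `θ : ℝ → ℂ`, there is an entire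
function `B : ℂ → ℂ` such that for all `s` with `Re(s) > -v/N`,
`∫_ℝ θ(y) |y|^{Ns+v-1} dy = Γ(Ns+v) · B(s)`. -/
theorem one_dim_zeta_gamma_factorization (N v : ℕ) (hN : 1 ≤ N) (hv : 1 ≤ v)
    (θ : SchwartzMap ℝ ℂ) :
    ∃ B : ℂ → ℂ, Differentiable ℂ B ∧
      ∀ s : ℂ, -((v : ℝ) / (N : ℝ)) < s.re →
        ∫ y : ℝ, θ y * ((|y| : ℝ) : ℂ) ^ ((N : ℂ) * s + (v : ℂ) - 1) =
          Complex.Gamma ((N : ℂ) * s + (v : ℂ)) * B s := by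
  obtain ⟨E, hE, hEθ⟩ := θ.exists_entire_mellin_eq_Gamma_mul
  obtain ⟨F, hF, hFθ⟩ := (SchwartzMap.compCLMOfContinuousLinearEquiv ℂ
    (ContinuousLinearEquiv.neg ℝ : ℝ ≃L[ℝ] ℝ) θ).exists_entire_mellin_eq_Gamma_mul
  refine ⟨fun s => E (N * s + v) + F (N * s + v), by fun_prop, fun s hs => ?_⟩
  have hN' : (0 : ℝ) < N := by exact_mod_cast hN
  have hw : 0 < ((N : ℂ) * s + (v : ℂ)).re := by
    rw [← neg_div, div_lt_iff₀ hN'] at hs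
    simp
    linarith
  rw [θ.integral_mul_abs_cpow hw, hEθ _ hw, hFθ _ hw, mul_add]
end

section
/- Let a and b be real numbers with a > −1, b > −1, and a + b < −1, and set c = −2 − a − b. Then ∫_ℝ |x|^{a} |1−x|^{b} dx = Γ(a+1)Γ(b+1)/Γ(a+b+2) + Γ(b+1)Γ(c+1)/Γ(b+c+2) + Γ(c+1)Γ(a+1)/Γ(c+a+2), where Γ is the Gamma function. -/
open MeasureTheory

open Set in
/-- Euler's beta integral with real exponents `p, q > -1`: convergence and value. -/
theorem integrableOn_and_integral_abs_rpow_mul_abs_one_sub_rpow_Ioo {p q : ℝ}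
    (hp : -1 < p) (hq : -1 < q) :
    IntegrableOn (fun x : ℝ => |x| ^ p * |1 - x| ^ q) (Ioo 0 1) ∧
      ∫ x in Ioo (0 : ℝ) 1, |x| ^ p * |1 - x| ^ q =
        Real.Gamma (p + 1) * Real.Gamma (q + 1) / Real.Gamma (p + q + 2) := by
  have hp' : 0 < p + 1 := by linarith
  have hq' : 0 < q + 1 := by linarith
  have heq : ∀ x ∈ Ioo (0 : ℝ) 1,
      (x : ℂ) ^ (((p + 1 : ℝ) : ℂ) - 1) * (1 - (x : ℂ)) ^ (((q + 1 : ℝ) : ℂ) - 1) =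
        ((|x| ^ p * |1 - x| ^ q : ℝ) : ℂ) := by
    intro x hx
    have hx1 : 0 < 1 - x := sub_pos.2 hx.2
    rw [abs_of_pos hx.1, abs_of_pos hx1]
    push_cast
    rw [Complex.ofReal_cpow hx.1.le, Complex.ofReal_cpow hx1.le]
    push_cast
    simp
  have hconv := Complex.betaIntegral_convergent (u := ((p + 1 : ℝ) : ℂ))
    (v := ((q + 1 : ℝ) : ℂ)) (by simpa using hp') (by simpa using hq')
  rw [intervalIntegrable_iff_integrableOn_Ioo_of_le zero_le_one] at hconv
  have hint : IntegrableOn (fun x : ℝ => ((|x| ^ p * |1 - x| ^ q : ℝ) : ℂ)) (Ioo 0 1) :=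
    hconv.congr_fun heq measurableSet_Ioo
  refine ⟨by simpa [IntegrableOn] using hint.re, ?_⟩
  have hval := Complex.betaIntegral_eq_Gamma_mul_div ((p + 1 : ℝ) : ℂ) ((q + 1 : ℝ) : ℂ)
    (by simpa using hp') (by simpa using hq')
  rw [Complex.betaIntegral, intervalIntegral.integral_of_le zero_le_one,
    integral_Ioc_eq_integral_Ioo, setIntegral_congr_fun measurableSet_Ioo heq,
    integral_complex_ofReal, ← Complex.ofReal_add, Complex.Gamma_ofReal, Complex.Gamma_ofReal,
    Complex.Gamma_ofReal] at hval
  rw [show p + q + 2 = p + 1 + (q + 1) by ring]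
  exact_mod_cast hval

open Set in
/-- The substitution `x = 1 / t` turns the integral over `(1, ∞)` into a beta integral. -/
theorem integrableOn_and_integral_abs_rpow_mul_abs_one_sub_rpow_Ioi {a b c : ℝ}
    (hb : -1 < b) (hab : a + b < -1) (hc : c = -2 - a - b) :
    IntegrableOn (fun x : ℝ => |x| ^ a * |1 - x| ^ b) (Ioi 1) ∧
      ∫ x in Ioi (1 : ℝ), |x| ^ a * |1 - x| ^ b =
        Real.Gamma (b + 1) * Real.Gamma (c + 1) / Real.Gamma (b + c + 2) := by
  obtain ⟨hi, hv⟩ := integrableOn_and_integral_abs_rpow_mul_abs_one_sub_rpow_Ioo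
    (p := c) (q := b) (by linarith) hb
  have himg : (fun t : ℝ => t⁻¹) '' Ioo 0 1 = Ioi 1 := by
    rw [image_inv_eq_inv, inv_Ioo_0_left one_pos, inv_one]
  have hd : ∀ t ∈ Ioo (0 : ℝ) 1,
      HasDerivWithinAt (fun t : ℝ => t⁻¹) (-(t ^ 2)⁻¹) (Ioo 0 1) t :=
    fun t ht => hasDerivWithinAt_inv ht.1.ne' _
  have hinj : InjOn (fun t : ℝ => t⁻¹) (Ioo 0 1) := inv_injective.injOn
  have heq : ∀ t ∈ Ioo (0 : ℝ) 1,
      |(-(t ^ 2)⁻¹ : ℝ)| • (|t⁻¹| ^ a * |1 - t⁻¹| ^ b) = |t| ^ c * |1 - t| ^ b := by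
    intro t ht
    have ht0 := ht.1
    have h1 : |1 - t⁻¹| = |1 - t| * t⁻¹ := by
      rw [show 1 - t⁻¹ = -((1 - t) * t⁻¹) by field_simp; ring, abs_neg, abs_mul,
        abs_of_pos (inv_pos.2 ht0)]
    rw [h1, abs_neg, abs_of_pos (inv_pos.2 (pow_pos ht0 2)), abs_of_pos (inv_pos.2 ht0),
      abs_of_pos ht0, Real.mul_rpow (abs_nonneg _) (inv_pos.2 ht0).le, Real.inv_rpow ht0.le,
      Real.inv_rpow ht0.le, hc, Real.rpow_sub ht0, Real.rpow_sub ht0, Real.rpow_neg ht0.le,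
      Real.rpow_two, smul_eq_mul]
    ring
  rw [← himg]
  constructor
  · rw [integrableOn_image_iff_integrableOn_abs_deriv_smul measurableSet_Ioo hd hinj]
    exact hi.congr_fun (fun t ht => (heq t ht).symm) measurableSet_Ioo
  · rw [integral_image_eq_integral_abs_deriv_smul measurableSet_Ioo hd hinj,
      setIntegral_congr_fun measurableSet_Ioo heq, hv, add_comm c b,
      mul_comm (Real.Gamma (c + 1))]

open Set in
/-- The reflection `x ↦ 1 - x` reduces the integral over `(-∞, 0)` to one over `(1, ∞)`. -/
theorem integrableOn_and_integral_abs_rpow_mul_abs_one_sub_rpow_Iio {a b c : ℝ}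
    (ha : -1 < a) (hab : a + b < -1) (hc : c = -2 - a - b) :
    IntegrableOn (fun x : ℝ => |x| ^ a * |1 - x| ^ b) (Iio 0) ∧
      ∫ x in Iio (0 : ℝ), |x| ^ a * |1 - x| ^ b =
        Real.Gamma (c + 1) * Real.Gamma (a + 1) / Real.Gamma (c + a + 2) := by
  obtain ⟨hi, hv⟩ := integrableOn_and_integral_abs_rpow_mul_abs_one_sub_rpow_Ioi
    (a := b) (b := a) (c := c) ha (by linarith) (by linarith)
  have himg : (fun t : ℝ => 1 - t) '' Ioi 1 = Iio 0 := by simp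
  have hd : ∀ t ∈ Ioi (1 : ℝ), HasDerivWithinAt (fun t : ℝ => 1 - t) (-1) (Ioi 1) t :=
    fun t _ => (hasDerivWithinAt_id t _).const_sub 1
  have hinj : InjOn (fun t : ℝ => 1 - t) (Ioi 1) := sub_right_injective.injOn
  have heq : ∀ t ∈ Ioi (1 : ℝ),
      |(-1 : ℝ)| • (|1 - t| ^ a * |1 - (1 - t)| ^ b) = |t| ^ b * |1 - t| ^ a := by
    intro t _
    simp [mul_comm]
  rw [← himg]
  constructor
  · rw [integrableOn_image_iff_integrableOn_abs_deriv_smul measurableSet_Ioi hd hinj]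
    exact hi.congr_fun (fun t ht => (heq t ht).symm) measurableSet_Ioi
  · rw [integral_image_eq_integral_abs_deriv_smul measurableSet_Ioi hd hinj,
      setIntegral_congr_fun measurableSet_Ioi heq, hv, add_comm c a,
      mul_comm (Real.Gamma (c + 1))]

/-- For real `a`, `b` with `a > -1`, `b > -1`, `a + b < -1` and `c = -2 - a - b`, the
Veneziano amplitude `∫_ℝ |x|^a |1-x|^b dx` equals
`Γ(a+1)Γ(b+1)/Γ(a+b+2) + Γ(b+1)Γ(c+1)/Γ(b+c+2) + Γ(c+1)Γ(a+1)/Γ(c+a+2)`. -/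
theorem veneziano_amplitude_as_sum_of_gammas (a b c : ℝ)
    (ha : -1 < a) (hb : -1 < b) (hab : a + b < -1) (hc : c = -2 - a - b) :
    ∫ x : ℝ, |x| ^ a * |1 - x| ^ b =
      Real.Gamma (a + 1) * Real.Gamma (b + 1) / Real.Gamma (a + b + 2) +
        Real.Gamma (b + 1) * Real.Gamma (c + 1) / Real.Gamma (b + c + 2) +
        Real.Gamma (c + 1) * Real.Gamma (a + 1) / Real.Gamma (c + a + 2) := by
  obtain ⟨hi₁, hv₁⟩ := integrableOn_and_integral_abs_rpow_mul_abs_one_sub_rpow_Ioo ha hb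
  obtain ⟨hi₂, hv₂⟩ := integrableOn_and_integral_abs_rpow_mul_abs_one_sub_rpow_Ioi hb hab hc
  obtain ⟨hi₃, hv₃⟩ := integrableOn_and_integral_abs_rpow_mul_abs_one_sub_rpow_Iio ha hab hc
  have hi₁' := (integrableOn_Ioc_iff_integrableOn_Ioo (by finiteness)).2 hi₁
  have hi₀ : IntegrableOn (fun x : ℝ => |x| ^ a * |1 - x| ^ b) (Set.Ioi 0) := by
    rw [← Set.Ioc_union_Ioi_eq_Ioi zero_le_one]
    exact hi₁'.union hi₂
  rw [← intervalIntegral.integral_Iic_add_Ioi ((integrableOn_Iic_iff_integrableOn_Iio (by finiteness)).2 hi₃) hi₀,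
    integral_Iic_eq_integral_Iio, ← Set.Ioc_union_Ioi_eq_Ioi (zero_le_one (α := ℝ)),
    setIntegral_union (Set.Ioc_disjoint_Ioi le_rfl) measurableSet_Ioi hi₁' hi₂,
    integral_Ioc_eq_integral_Ioo, hv₁, hv₂, hv₃]
  ring
end
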